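/- arXiv:2211.10032 — 2 statements merged into one kernel-verified Lean document; each statement's English description precedes it below -/
import Mathlib

section
/- Let n, p be positive integers, let X be a real n×p matrix, Y ∈ ℝ^n, and let Π_x, Π_y be real n×n matrices with Π_y symmetric. Define m_x = Π_x X and m_y = Π_y Y. Then for every θ ∈ ℝ^p, m_y^T X θ + Y^T m_x θ − m_y^T m_x θ = Y^T (Π_y + Π_x − Π_y Π_x) X θ. Consequently, the modular objective θ ↦ (1/n)(θ^T X^T X θ / 2 − m_y^T X θ − Y^T m_x θ + m_y^T m_x θ) + λ‖θ‖₁ coincides with the Lasso-type objective θ ↦ (1/n)(θ^T X^T X θ / 2 − Y^T (Π_y + Π_x − Π_y Π_x) X θ) + λ‖θ‖₁ for every λ ≥ 0 and every θ ∈ ℝ^p. -/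
open Matrix Finset

/-- Linear-transformation computational shortcut (Section 3.4): with projection-type
estimates `m_x = Πx X`, `m_y = Πy Y` (`Πy` symmetric), the modular objective coincides
with a Lasso objective with transformed response. -/
theorem stmt_4 (n p : ℕ) (hn : 0 < n) (hp : 0 < p)
    (X : Matrix (Fin n) (Fin p) ℝ) (Y : Fin n → ℝ)
    (Pix Piy : Matrix (Fin n) (Fin n) ℝ) (hPiy : Piyᵀ = Piy)
    (mx : Matrix (Fin n) (Fin p) ℝ) (hmx : mx = Pix * X)
    (my : Fin n → ℝ) (hmy : my = Piy.mulVec Y) :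
    (∀ θ : Fin p → ℝ,
      my ⬝ᵥ X.mulVec θ + Y ⬝ᵥ mx.mulVec θ - my ⬝ᵥ mx.mulVec θ
        = Y ⬝ᵥ ((Piy + Pix - Piy * Pix) * X).mulVec θ) ∧
    (∀ lam : ℝ, 0 ≤ lam → ∀ θ : Fin p → ℝ,
      (1 / (n : ℝ)) * ((θ ⬝ᵥ (Xᵀ * X).mulVec θ) / 2
            - my ⬝ᵥ X.mulVec θ - Y ⬝ᵥ mx.mulVec θ + my ⬝ᵥ mx.mulVec θ)
          + lam * ∑ j, |θ j|
        = (1 / (n : ℝ)) * ((θ ⬝ᵥ (Xᵀ * X).mulVec θ) / 2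
            - Y ⬝ᵥ ((Piy + Pix - Piy * Pix) * X).mulVec θ)
          + lam * ∑ j, |θ j|) := by
  have key : ∀ v : Fin n → ℝ, my ⬝ᵥ v = Y ⬝ᵥ Piy.mulVec v := by
    intro v
    rw [hmy, Matrix.dotProduct_mulVec, ← Matrix.mulVec_transpose, hPiy]
  have h1 : ∀ θ : Fin p → ℝ,
      my ⬝ᵥ X.mulVec θ + Y ⬝ᵥ mx.mulVec θ - my ⬝ᵥ mx.mulVec θ
        = Y ⬝ᵥ ((Piy + Pix - Piy * Pix) * X).mulVec θ := by
    intro θ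
    rw [key, key, hmx]
    simp only [← Matrix.mulVec_mulVec, Matrix.add_mulVec, Matrix.sub_mulVec,
      dotProduct_add, dotProduct_sub]
  refine ⟨h1, ?_⟩
  intro lam _ θ
  rw [← h1 θ]
  ring
end

section
/- Work on a probability space (Ω, 𝓕, P). Let X, Y, Z be random variables with values in standard Borel spaces such that X and Y are conditionally independent given Z, i.e., the σ-algebras σ(X) and σ(Y) are conditionally independent given σ(Z). Let U be a bounded real-valued random variable measurable with respect to σ(X), and let V be a bounded real-valued random variable measurable with respect to σ(Y). Then E[ E[U | σ(Z)]·V + U·E[V | σ(Z)] − E[U | σ(Z)]·E[V | σ(Z)] ] = E[U·V]. -/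
open MeasureTheory ProbabilityTheory

theorem stmt6_condExp_mul {Ω : Type*} {m mΩ : MeasurableSpace Ω} [StandardBorelSpace Ω]
    (P : Measure Ω) [IsProbabilityMeasure P] (hle : m ≤ mΩ) {U V : Ω → ℝ}
    (h : CondIndepFun m hle U V P) (hU : Measurable U) (hV : Measurable V)
    (hUi : Integrable U P) (hVi : Integrable V P) (hUV : Integrable (fun ω => U ω * V ω) P) :
    P[fun ω => U ω * V ω|m] =ᵐ[P] fun ω => (P[U|m]) ω * (P[V|m]) ω := by
  have h1 := ae_of_ae_trim hle ((condIndepFun_iff_map_prod_eq_prod_map_map hU hV).1 h)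
  filter_upwards [h1, condExp_ae_eq_integral_condExpKernel hle hUV,
    condExp_ae_eq_integral_condExpKernel hle hUi,
    condExp_ae_eq_integral_condExpKernel hle hVi] with ω h1 h2 h3 h4
  rw [h2, h3, h4]
  rw [Kernel.map_apply _ (hU.prodMk hV), Kernel.prod_apply, Kernel.map_apply _ hU,
    Kernel.map_apply _ hV] at h1
  have hi : IndepFun U V (condExpKernel P m ω) :=
    (indepFun_iff_map_prod_eq_prod_map_map hU.aemeasurable hV.aemeasurable).2 h1
  exact hi.integral_fun_mul_eq_mul_integral hU.aestronglyMeasurable hV.aestronglyMeasurable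

theorem stmt6_integral_aux {Ω : Type*} {m mΩ : MeasurableSpace Ω} [StandardBorelSpace Ω]
    (P : Measure Ω) [IsProbabilityMeasure P] (hle : m ≤ mΩ) {U V : Ω → ℝ}
    (h : CondIndepFun m hle U V P) (hU : Measurable U) (hV : Measurable V)
    (CU : ℝ) (hUbdd : ∀ ω, |U ω| ≤ CU)
    (CV : ℝ) (hVbdd : ∀ ω, |V ω| ≤ CV) :
    ∫ ω, ((P[U|m]) ω * V ω + U ω * (P[V|m]) ω - (P[U|m]) ω * (P[V|m]) ω) ∂P
      = ∫ ω, U ω * V ω ∂P := by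
  have hUi : Integrable U P := .of_bound hU.aestronglyMeasurable CU (.of_forall hUbdd)
  have hVi : Integrable V P := .of_bound hV.aestronglyMeasurable CV (.of_forall hVbdd)
  have bU : ∀ᵐ ω ∂P, ‖(P[U|m]) ω‖ ≤ CU := ae_bdd_abs_condExp_of_ae_bdd_abs (.of_forall hUbdd)
  have bV : ∀ᵐ ω ∂P, ‖(P[V|m]) ω‖ ≤ CV := ae_bdd_abs_condExp_of_ae_bdd_abs (.of_forall hVbdd)
  have sU : StronglyMeasurable[m] (P[U|m]) := stronglyMeasurable_condExp
  have sV : StronglyMeasurable[m] (P[V|m]) := stronglyMeasurable_condExp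
  have mU : AEStronglyMeasurable (P[U|m]) P := (sU.mono hle).aestronglyMeasurable
  have mV : AEStronglyMeasurable (P[V|m]) P := (sV.mono hle).aestronglyMeasurable
  have i1 : Integrable (fun ω => U ω * V ω) P := hVi.bdd_mul hU.aestronglyMeasurable
    (.of_forall hUbdd)
  have i2 : Integrable (fun ω => (P[U|m]) ω * V ω) P := hVi.bdd_mul mU bU
  have i3 : Integrable (fun ω => U ω * (P[V|m]) ω) P := hUi.mul_bdd mV bV
  have i4 : Integrable (fun ω => (P[U|m]) ω * (P[V|m]) ω) P := integrable_condExp.bdd_mul mU bU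
  have i5 : Integrable (fun ω => (P[U|m]) ω * V ω + U ω * (P[V|m]) ω) P := i2.add i3
  rw [integral_sub i5 i4, integral_add i2 i3]
  have e1 : ∫ ω, U ω * V ω ∂P = ∫ ω, (P[U|m]) ω * (P[V|m]) ω ∂P := by
    rw [← integral_condExp hle]
    exact integral_congr_ae (stmt6_condExp_mul P hle h hU hV hUi hVi i1)
  have e2 : ∫ ω, (P[U|m]) ω * V ω ∂P = ∫ ω, (P[U|m]) ω * (P[V|m]) ω ∂P := by
    rw [← integral_condExp hle]
    exact integral_congr_ae (condExp_mul_of_stronglyMeasurable_left sU i2 hVi)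
  have e3 : ∫ ω, U ω * (P[V|m]) ω ∂P = ∫ ω, (P[U|m]) ω * (P[V|m]) ω ∂P := by
    rw [← integral_condExp hle]
    exact integral_congr_ae (condExp_mul_of_stronglyMeasurable_right sV i3 hUi)
  rw [e1, e2, e3]
  ring

/-- Unbiasedness of the modular proxy cross-term in its general form (Theorem A.2):
for bounded `U` measurable w.r.t. σ(X) and bounded `V` measurable w.r.t. σ(Y), with
X and Y conditionally independent given Z,
`E[E[U|σ(Z)]·V + U·E[V|σ(Z)] − E[U|σ(Z)]·E[V|σ(Z)]] = E[U·V]`. -/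
theorem stmt_6 {Ω : Type*} {mΩ : MeasurableSpace Ω} [StandardBorelSpace Ω] [Nonempty Ω]
    (P : Measure Ω) [IsProbabilityMeasure P]
    {EX EY EZ : Type*} [MeasurableSpace EX] [StandardBorelSpace EX]
    [MeasurableSpace EY] [StandardBorelSpace EY]
    [MeasurableSpace EZ] [StandardBorelSpace EZ]
    (X : Ω → EX) (Y : Ω → EY) (Z : Ω → EZ)
    (hX : Measurable X) (hY : Measurable Y) (hZ : Measurable Z)
    (mZ : MeasurableSpace Ω) (hmZ : mZ = MeasurableSpace.comap Z inferInstance)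
    (hle : mZ ≤ mΩ)
    (hCI : CondIndepFun mZ hle X Y P)
    (U V : Ω → ℝ)
    (hU : Measurable[MeasurableSpace.comap X inferInstance] U)
    (hV : Measurable[MeasurableSpace.comap Y inferInstance] V)
    (CU : ℝ) (hUbdd : ∀ ω, |U ω| ≤ CU)
    (CV : ℝ) (hVbdd : ∀ ω, |V ω| ≤ CV) :
    ∫ ω, ((P[U|mZ]) ω * V ω + U ω * (P[V|mZ]) ω - (P[U|mZ]) ω * (P[V|mZ]) ω) ∂P
      = ∫ ω, U ω * V ω ∂P := by
  refine stmt6_integral_aux P hle ?_ (hU.mono hX.comap_le le_rfl) (hV.mono hY.comap_le le_rfl)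
    CU hUbdd CV hVbdd
  rw [condIndepFun_iff_condIndep] at hCI ⊢
  exact condIndep_of_condIndep_of_le_left (condIndep_of_condIndep_of_le_right hCI hV.comap_le)
    hU.comap_le
end
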